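/- arXiv:2012.01628 — 3 statements merged into one kernel-verified Lean document; each statement's English description precedes it below -/
import Mathlib

section
/- (Shift-invariant formula) For any nodes a_0, …, a_{n−1} ∈ F and any t ∈ F, the identity g̃_n(x + t; a_0 + t, a_1 + t, …, a_{n−1} + t) = g̃_n(x; a_0, a_1, …, a_{n−1}) holds in F[x]; that is, composing g̃_n(·; a_0 + t, …, a_{n−1} + t) with x ↦ x + t yields g̃_n(·; a_0, …, a_{n−1}). -/
open Polynomial Finset

/-- The backward difference operator `(Δ p)(x) = p(x) - p(x-1)` on `F[x]`. -/
noncomputable def bdiff {F : Type*} [Field F] (p : F[X]) : F[X] :=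
  p - p.comp (X - C 1)

/-- The upper (rising) factorial `t^{(0)} = 1`, `t^{(k)} = t(t+1)⋯(t+k-1)`,
in a commutative ring. -/
def upf {R : Type*} [CommRing R] (t : R) : ℕ → R
  | 0 => 1
  | k + 1 => upf t k * (t + (k : R))

/-- `g` is the `n`-th univariate difference Gončarov polynomial
`g̃_n(x; a_0, …, a_{n-1})` for the nodes `a`: it is the unique polynomial of
degree `n` satisfying the biorthogonality conditions `(Δ^s g)(a_s) = n!·δ_{s,n}`
for `0 ≤ s ≤ n`.  (For `s = n` the condition says that the constant polynomial
`Δ^n g` equals `n!`; together with `natDegree g ≤ n` this forces the degree to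
be exactly `n`.)  Only the nodes `a_0, …, a_{n-1}` are used. -/
def IsDiffGoncarov {F : Type*} [Field F] (n : ℕ) (a : ℕ → F) (g : F[X]) : Prop :=
  g.natDegree ≤ n ∧ (∀ s < n, (bdiff^[s] g).eval (a s) = 0) ∧
    bdiff^[n] g = C (n.factorial : F)

theorem bdiff_sub_aux {F : Type*} [Field F] (p q : F[X]) :
    bdiff (p - q) = bdiff p - bdiff q := by
  simp only [bdiff, sub_comp]
  ring

theorem bdiff_iter_sub_aux {F : Type*} [Field F] (s : ℕ) (p q : F[X]) :
    bdiff^[s] (p - q) = bdiff^[s] p - bdiff^[s] q := by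
  induction s generalizing p q with
  | zero => rfl
  | succ k ih => simp only [Function.iterate_succ_apply, bdiff_sub_aux, ih]

theorem bdiff_comp_aux {F : Type*} [Field F] (t : F) (p : F[X]) :
    bdiff (p.comp (X + C t)) = (bdiff p).comp (X + C t) := by
  simp only [bdiff, sub_comp, comp_assoc, add_comp, X_comp, C_comp]
  congr 2
  ring

theorem bdiff_iter_comp_aux {F : Type*} [Field F] (t : F) (s : ℕ) (p : F[X]) :
    bdiff^[s] (p.comp (X + C t)) = (bdiff^[s] p).comp (X + C t) := by
  induction s generalizing p with
  | zero => rfl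
  | succ k ih => simp only [Function.iterate_succ_apply, bdiff_comp_aux, ih]

theorem eq_zero_of_bdiff_aux {F : Type*} [Field F] [CharZero F] (p : F[X]) (b : F)
    (h : bdiff p = 0) (hb : p.eval b = 0) : p = 0 := by
  have key : ∀ k : ℕ, p.eval (b - k) = 0 := by
    intro k
    induction k with
    | zero => simpa using hb
    | succ k ih =>
      have h1 := congrArg (Polynomial.eval (b - k)) h
      simp only [bdiff, eval_sub, eval_comp, eval_X, eval_C, eval_zero, ih, zero_sub,
        neg_eq_zero] at h1
      rw [← h1]
      congr 1
      push_cast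
      ring
  apply Polynomial.eq_zero_of_infinite_isRoot
  refine (Set.infinite_range_of_injective (f := fun k : ℕ => b - (k : F)) ?_).mono ?_
  · intro i j hij
    simpa using hij
  · rintro _ ⟨k, rfl⟩
    exact key k

theorem eq_zero_of_bdiff_iter_aux {F : Type*} [Field F] [CharZero F] (n : ℕ) (a : ℕ → F)
    (p : F[X]) (h : ∀ s < n, (bdiff^[s] p).eval (a s) = 0) (hn : bdiff^[n] p = 0) :
    p = 0 := by
  induction n generalizing a p with
  | zero => exact hn
  | succ n ih =>
    refine eq_zero_of_bdiff_aux p (a 0) ?_ (h 0 (Nat.succ_pos n))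
    exact ih (fun i => a (i + 1)) (bdiff p) (fun s hs => h (s + 1) (Nat.succ_lt_succ hs)) hn

/-- **Shift-invariant formula.** For nodes `a_0, …, a_{n-1}` and `t ∈ F`,
`g̃_n(x + t; a_0 + t, …, a_{n-1} + t) = g̃_n(x; a_0, …, a_{n-1})`: composing the
Gončarov polynomial for the shifted nodes with `x ↦ x + t` yields the Gončarov
polynomial for the original nodes. -/
theorem shift_invariant_formula (F : Type*) [Field F] [CharZero F] (n : ℕ)
    (a : ℕ → F) (t : F) (g gt : F[X])
    (hg : IsDiffGoncarov n a g)
    (hgt : IsDiffGoncarov n (fun i => a i + t) gt) :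
    gt.comp (X + C t) = g := by
  obtain ⟨-, h1, h2⟩ := hg
  obtain ⟨-, h3, h4⟩ := hgt
  apply sub_eq_zero.mp
  apply eq_zero_of_bdiff_iter_aux n a
  · intro s hs
    rw [bdiff_iter_sub_aux, bdiff_iter_comp_aux, eval_sub, h1 s hs, eval_comp]
    simpa using h3 s hs
  · rw [bdiff_iter_sub_aux, bdiff_iter_comp_aux, h2, h4, C_comp, sub_self]
end

section
/- (Difference relations) Let Z be a node set and m, n ∈ ℕ. If m ≥ 1 then Δ_x g̃_{m,n}((x,y); Z) = m · g̃_{m−1,n}((x,y); LZ), and if n ≥ 1 then Δ_y g̃_{m,n}((x,y); Z) = n · g̃_{m,n−1}((x,y); DZ). -/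
open Finset

/-- The partial backward difference operator in the first variable:
`(Δ_x p)(x,y) = p(x,y) - p(x-1,y)`. -/
noncomputable def bdiffx {F : Type*} [Field F] (p : MvPolynomial (Fin 2) F) :
    MvPolynomial (Fin 2) F :=
  p - MvPolynomial.aeval ![MvPolynomial.X 0 - 1, MvPolynomial.X 1] p

/-- The partial backward difference operator in the second variable:
`(Δ_y p)(x,y) = p(x,y) - p(x,y-1)`. -/
noncomputable def bdiffy {F : Type*} [Field F] (p : MvPolynomial (Fin 2) F) :
    MvPolynomial (Fin 2) F :=
  p - MvPolynomial.aeval ![MvPolynomial.X 0, MvPolynomial.X 1 - 1] p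

/-- `g` is the bivariate difference Gončarov polynomial `g̃_{m,n}((x,y); Z)` for
the node set `Z = {z_{i,j}}`: it is the unique polynomial of degree at most `m`
in `x` and at most `n` in `y` satisfying
`(Δ_x^i Δ_y^j g)(z_{i,j}) = m!·n!·δ_{i,m}·δ_{j,n}` for all `(i,j) ≼ (m,n)`. -/
def IsDiffGoncarov2 {F : Type*} [Field F] (m n : ℕ) (Z : ℕ → ℕ → F × F)
    (g : MvPolynomial (Fin 2) F) : Prop :=
  g.degreeOf 0 ≤ m ∧ g.degreeOf 1 ≤ n ∧
    ∀ i ≤ m, ∀ j ≤ n,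
      MvPolynomial.eval ![(Z i j).1, (Z i j).2] (bdiffx^[i] (bdiffy^[j] g)) =
        if i = m ∧ j = n then ((m.factorial : F) * (n.factorial : F)) else 0

open MvPolynomial in
/-- Backward difference in the variable `k`, as a linear map. -/
noncomputable def bD (F : Type*) [Field F] (k : Fin 2) :
    Module.End F (MvPolynomial (Fin 2) F) :=
  LinearMap.id - (aeval (fun l : Fin 2 => (X l - if l = k then 1 else 0 :
    MvPolynomial (Fin 2) F)) : MvPolynomial (Fin 2) F →ₐ[F] MvPolynomial (Fin 2) F).toLinearMap

open MvPolynomial in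
lemma bD_apply {F : Type*} [Field F] (k : Fin 2) (p : MvPolynomial (Fin 2) F) :
    bD F k p = p - aeval (fun l : Fin 2 => (X l - if l = k then 1 else 0 :
      MvPolynomial (Fin 2) F)) p := rfl

lemma bdiffx_eq {F : Type*} [Field F] :
    (bdiffx : MvPolynomial (Fin 2) F → _) = ⇑(bD F 0) := by
  funext p
  rw [bD_apply, bdiffx]
  congr 3
  funext l
  fin_cases l <;> simp

lemma bdiffy_eq {F : Type*} [Field F] :
    (bdiffy : MvPolynomial (Fin 2) F → _) = ⇑(bD F 1) := by
  funext p
  rw [bD_apply, bdiffy]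
  congr 3
  funext l
  fin_cases l <;> simp

open MvPolynomial in
lemma bD_comm {F : Type*} [Field F] : Commute (bD F 0) (bD F 1) := by
  have h : ((aeval (fun l : Fin 2 => (X l - if l = 0 then 1 else 0 :
      MvPolynomial (Fin 2) F)) : MvPolynomial (Fin 2) F →ₐ[F] MvPolynomial (Fin 2) F).comp
      (aeval (fun l : Fin 2 => (X l - if l = 1 then 1 else 0 : MvPolynomial (Fin 2) F)))) =
      ((aeval (fun l : Fin 2 => (X l - if l = 1 then 1 else 0 :
      MvPolynomial (Fin 2) F)) : MvPolynomial (Fin 2) F →ₐ[F] MvPolynomial (Fin 2) F).comp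
      (aeval (fun l : Fin 2 => (X l - if l = 0 then 1 else 0 : MvPolynomial (Fin 2) F)))) := by
    apply MvPolynomial.algHom_ext
    intro l
    fin_cases l <;> simp
  apply LinearMap.ext
  intro p
  have hp := DFunLike.congr_fun h p
  rw [AlgHom.comp_apply, AlgHom.comp_apply] at hp
  rw [Module.End.mul_apply, Module.End.mul_apply]
  simp only [bD_apply, map_sub] at hp ⊢
  rw [hp]
  abel

open MvPolynomial in
lemma deg_one_sub {F : Type*} [Field F] (k l : Fin 2) :
    degreeOf l (X k - 1 : MvPolynomial (Fin 2) F) ≤ if l = k then 1 else 0 := by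
  refine (degreeOf_sub_le _ _ _).trans ?_
  simp [degreeOf_X]

open MvPolynomial in
lemma deg_pow_diff {F : Type*} [Field F] (k l : Fin 2) (a : ℕ) :
    degreeOf l (X k ^ a - (X k - 1) ^ a : MvPolynomial (Fin 2) F) ≤
      if l = k then a - 1 else 0 := by
  have h := geom_sum₂_mul (X k : MvPolynomial (Fin 2) F) (X k - 1) a
  rw [sub_sub_cancel, mul_one] at h
  rw [← h]
  refine (degreeOf_sum_le _ _ _).trans (Finset.sup_le ?_)
  intro i hi
  rw [Finset.mem_range] at hi
  refine (degreeOf_mul_le _ _ _).trans ?_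
  have h1 := degreeOf_pow_le l (X k : MvPolynomial (Fin 2) F) i
  have h2 := degreeOf_pow_le l (X k - 1 : MvPolynomial (Fin 2) F) (a - 1 - i)
  have h3 := deg_one_sub (F := F) k l
  rw [degreeOf_X] at h1
  have h4 := Nat.mul_le_mul_left (a - 1 - i) h3
  by_cases hlk : l = k
  · simp only [hlk, if_true] at *
    omega
  · simp only [hlk, if_false] at *
    omega

open MvPolynomial in
/-- `bD` of a monomial, with `l` the other variable. -/
lemma bD_mono {F : Type*} [Field F] (k l : Fin 2) (hkl : l ≠ k) (s : Fin 2 →₀ ℕ) (c : F) :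
    bD F k (monomial s c) = C c * ((X k ^ s k - (X k - 1) ^ s k) * X l ^ s l) := by
  have : monomial s c = C c * (X k ^ s k * X l ^ s l) := by
    rw [monomial_eq, Finsupp.prod_fintype _ _ (by simp), Fin.prod_univ_two]
    fin_cases k <;> fin_cases l
    · exact absurd rfl hkl
    · rfl
    · exact congrArg _ (mul_comm _ _)
    · exact absurd rfl hkl
  rw [this, bD_apply]
  simp [hkl]
  ring

open MvPolynomial in
lemma bD_deg {F : Type*} [Field F] (k l : Fin 2) (hkl : l ≠ k) (p : MvPolynomial (Fin 2) F)
    (m n : ℕ) (hm : degreeOf k p ≤ m) (hn : degreeOf l p ≤ n) :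
    degreeOf k (bD F k p) ≤ m - 1 ∧ degreeOf l (bD F k p) ≤ n ∧ (m = 0 → bD F k p = 0) := by
  have hs : bD F k p = ∑ s ∈ p.support, bD F k (monomial s (coeff s p)) := by
    conv_lhs => rw [p.as_sum, map_sum]
  rw [hs]
  have hsm : ∀ s ∈ p.support, s k ≤ m := fun s h => (degreeOf_le_iff.1 hm) s h
  have hsn : ∀ s ∈ p.support, s l ≤ n := fun s h => (degreeOf_le_iff.1 hn) s h
  refine ⟨(degreeOf_sum_le _ _ _).trans (Finset.sup_le ?_),
    (degreeOf_sum_le _ _ _).trans (Finset.sup_le ?_), ?_⟩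
  · intro s h
    rw [bD_mono k l hkl]
    refine (degreeOf_C_mul_le _ _ _).trans ((degreeOf_mul_le _ _ _).trans ?_)
    have h1 := deg_pow_diff (F := F) k k (s k)
    have h2 := degreeOf_pow_le k (X l : MvPolynomial (Fin 2) F) (s l)
    have := hsm s h
    rw [degreeOf_X, if_neg hkl.symm] at h2
    rw [if_pos rfl] at h1
    omega
  · intro s h
    rw [bD_mono k l hkl]
    refine (degreeOf_C_mul_le _ _ _).trans ((degreeOf_mul_le _ _ _).trans ?_)
    have h1 := deg_pow_diff (F := F) k l (s k)
    have h2 := degreeOf_pow_le l (X l : MvPolynomial (Fin 2) F) (s l)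
    have := hsn s h
    rw [degreeOf_X, if_pos rfl] at h2
    rw [if_neg hkl] at h1
    omega
  · intro h0
    refine Finset.sum_eq_zero fun s h => ?_
    have := hsm s h
    rw [bD_mono k l hkl, show s k = 0 by omega]
    simp

open MvPolynomial in
lemma bD_const {F : Type*} [Field F] [CharZero F] (p : MvPolynomial (Fin 2) F)
    (hx : bD F 0 p = 0) (hy : bD F 1 p = 0) (v : Fin 2 → F) : p = C (eval v p) := by
  have key : ∀ k : Fin 2, bD F k p = 0 → ∀ w : Fin 2 → F,
      eval (fun l => w l - if l = k then 1 else 0) p = eval w p := by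
    intro k hk w
    rw [bD_apply, sub_eq_zero] at hk
    conv_rhs => rw [hk]
    rw [← MvPolynomial.coe_aeval_eq_eval, ← MvPolynomial.coe_aeval_eq_eval]
    change _ = ((aeval w).comp (aeval _)) p
    rw [comp_aeval]
    change (aeval _) p = _
    congr 2
    funext l
    split_ifs <;> simp
  have h2 : ∀ a b : ℕ, eval ![v 0 - a, v 1 - b] p = eval v p := by
    intro a
    induction a with
    | zero =>
      intro b
      induction b with
      | zero =>
        congr 2
        funext l
        fin_cases l <;> simp
      | succ b ih =>
        rw [← ih, ← key 1 hy ![v 0 - (0 : ℕ), v 1 - b]]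
        congr 2
        funext l
        fin_cases l <;> simp <;> ring
    | succ a ih =>
      intro b
      rw [← ih b, ← key 0 hx ![v 0 - a, v 1 - b]]
      congr 2
      funext l
      fin_cases l <;> simp <;> ring
  refine MvPolynomial.funext_set (fun k => Set.range fun a : ℕ => v k - a) (fun k => ?_) ?_
  · apply Set.infinite_range_of_injective
    intro a b h
    simpa using h
  · intro w hw
    obtain ⟨a, ha⟩ := hw 0 (Set.mem_univ _)
    obtain ⟨b, hb⟩ := hw 1 (Set.mem_univ _)
    rw [eval_C, ← h2 a b]
    congr 2
    funext l
    fin_cases l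
    · exact ha.symm
    · exact hb.symm

open MvPolynomial in
lemma bD_unique {F : Type*} [Field F] [CharZero F] (N : ℕ) :
    ∀ (m n : ℕ) (_ : m + n ≤ N) (Z : ℕ → ℕ → F × F) (p : MvPolynomial (Fin 2) F)
    (_ : degreeOf 0 p ≤ m) (_ : degreeOf 1 p ≤ n)
    (_ : ∀ i ≤ m, ∀ j ≤ n,
      eval ![(Z i j).1, (Z i j).2] ((bD F 0 ^ i) ((bD F 1 ^ j) p)) = 0), p = 0 := by
  induction N with
  | zero =>
    intro m n hN Z p hm hn h
    have hx := (bD_deg 0 1 (by decide) p m n hm hn).2.2 (by omega)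
    have hy := (bD_deg 1 0 (by decide) p n m hn hm).2.2 (by omega)
    rw [bD_const p hx hy ![(Z 0 0).1, (Z 0 0).2]]
    simpa using h 0 (by omega) 0 (by omega)
  | succ N ih =>
    intro m n hN Z p hm hn h
    obtain ⟨x1, x2, x3⟩ := bD_deg 0 1 (by decide) p m n hm hn
    obtain ⟨y1, y2, y3⟩ := bD_deg 1 0 (by decide) p n m hn hm
    have hx : bD F 0 p = 0 := by
      rcases Nat.eq_zero_or_pos m with h0 | h0
      · exact x3 h0
      · refine ih (m - 1) n (by omega) (fun i j => Z (i + 1) j) _ x1 x2 ?_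
        intro i hi j hj
        have := h (i + 1) (by omega) j hj
        rw [pow_succ, Module.End.mul_apply, ← Module.End.mul_apply (bD F 0) (bD F 1 ^ j),
          (bD_comm.pow_right j).eq] at this
        exact this
    have hy : bD F 1 p = 0 := by
      rcases Nat.eq_zero_or_pos n with h0 | h0
      · exact y3 h0
      · refine ih m (n - 1) (by omega) (fun i j => Z i (j + 1)) _ y2 y1 ?_
        intro i hi j hj
        have := h i hi (j + 1) (by omega)
        rw [pow_succ (bD F 1) j] at this
        exact this
    rw [bD_const p hx hy ![(Z 0 0).1, (Z 0 0).2]]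
    simpa using h 0 (by omega) 0 (by omega)

/-- **Difference relations.** If `m ≥ 1` then
`Δ_x g̃_{m,n}((x,y); Z) = m · g̃_{m-1,n}((x,y); LZ)`, and if `n ≥ 1` then
`Δ_y g̃_{m,n}((x,y); Z) = n · g̃_{m,n-1}((x,y); DZ)`, where `LZ` (resp. `DZ`) is the
node set whose `(i,j)`-node is `z_{i+1,j}` (resp. `z_{i,j+1}`). -/
theorem difference_relations (F : Type*) [Field F] [CharZero F]
    (m n : ℕ) (Z : ℕ → ℕ → F × F) (g gL gD : MvPolynomial (Fin 2) F)
    (hg : IsDiffGoncarov2 m n Z g)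
    (hgL : IsDiffGoncarov2 (m - 1) n (fun i j => Z (i + 1) j) gL)
    (hgD : IsDiffGoncarov2 m (n - 1) (fun i j => Z i (j + 1)) gD) :
    (1 ≤ m → bdiffx g = MvPolynomial.C (m : F) * gL) ∧
    (1 ≤ n → bdiffy g = MvPolynomial.C (n : F) * gD) := by
  obtain ⟨g0, g1, g2⟩ := hg
  obtain ⟨l0, l1, l2⟩ := hgL
  obtain ⟨d0, d1, d2⟩ := hgD
  simp only [bdiffx_eq, bdiffy_eq, ← Module.End.pow_apply] at *
  obtain ⟨x1, x2, -⟩ := bD_deg 0 1 (by decide) g m n g0 g1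
  obtain ⟨y1, y2, -⟩ := bD_deg 1 0 (by decide) g n m g1 g0
  constructor
  · intro hm
    rw [← sub_eq_zero]
    refine bD_unique _ (m - 1) n le_rfl (fun i j => Z (i + 1) j) _ ?_ ?_ ?_
    · exact (MvPolynomial.degreeOf_sub_le _ _ _).trans
        (max_le x1 ((MvPolynomial.degreeOf_C_mul_le _ _ _).trans l0))
    · exact (MvPolynomial.degreeOf_sub_le _ _ _).trans
        (max_le x2 ((MvPolynomial.degreeOf_C_mul_le _ _ _).trans l1))
    · intro i hi j hj
      have a := g2 (i + 1) (by omega) j hj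
      have b := l2 i hi j hj
      rw [pow_succ, Module.End.mul_apply, ← Module.End.mul_apply (bD F 0) (bD F 1 ^ j),
          (bD_comm.pow_right j).eq, Module.End.mul_apply] at a
      rw [← MvPolynomial.smul_eq_C_mul, map_sub, map_sub, map_sub, map_smul, map_smul,
        MvPolynomial.smul_eval, a, b]
      obtain ⟨k, rfl⟩ : ∃ k, m = k + 1 := ⟨m - 1, by omega⟩
      simp only [Nat.add_sub_cancel, Nat.add_right_cancel_iff, Nat.factorial_succ]
      split_ifs <;> push_cast <;> ring
  · intro hn
    rw [← sub_eq_zero]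
    refine bD_unique _ m (n - 1) le_rfl (fun i j => Z i (j + 1)) _ ?_ ?_ ?_
    · exact (MvPolynomial.degreeOf_sub_le _ _ _).trans
        (max_le y2 ((MvPolynomial.degreeOf_C_mul_le _ _ _).trans d0))
    · exact (MvPolynomial.degreeOf_sub_le _ _ _).trans
        (max_le y1 ((MvPolynomial.degreeOf_C_mul_le _ _ _).trans d1))
    · intro i hi j hj
      have a := g2 i hi (j + 1) (by omega)
      have b := d2 i hi j hj
      rw [pow_succ (bD F 1) j, Module.End.mul_apply] at a
      rw [← MvPolynomial.smul_eq_C_mul, map_sub, map_sub, map_sub, map_smul, map_smul,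
        MvPolynomial.smul_eval, a, b]
      obtain ⟨k, rfl⟩ : ∃ k, n = k + 1 := ⟨n - 1, by omega⟩
      simp only [Nat.add_sub_cancel, Nat.add_right_cancel_iff, Nat.factorial_succ]
      split_ifs <;> push_cast <;> ring
end

section
/- (Main combinatorial interpretation) Let x, y, m, n be positive integers and let U = {(u_{i,j}, v_{i,j}) : 0 ≤ i ≤ m, 0 ≤ j ≤ n} ⊂ ℕ² satisfy: u_{i,j} ≤ u_{i',j'} and v_{i,j} ≤ v_{i',j'} whenever i ≤ i' and j ≤ j', together with 1 ≤ u_{i,j} ≤ x and 1 ≤ v_{i,j} ≤ y for all i, j. Let N be the number of pairs (a, b) of integer sequences with 0 ≤ a_0 ≤ ⋯ ≤ a_{m−1} < x and 0 ≤ b_0 ≤ ⋯ ≤ b_{n−1} < y that are bounded by at least one lattice path P from (0,0) to (m,n) with respect to U. Then N = (1/(m!·n!)) · g̃_{m,n}((x,y); Z), where g̃_{m,n} is the bivariate difference Gončarov polynomial over ℚ for the node set Z with z_{i,j} = (x − u_{i,j}, y − v_{i,j}), evaluated at the point (x,y). -/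
open Finset

/-- The number of east steps (`true`) of the step sequence `s` strictly before
position `r`. -/
def eastsBefore {mn : ℕ} (s : Fin mn → Bool) (r : Fin mn) : ℕ :=
  (Finset.univ.filter fun r' : Fin mn => r' < r ∧ s r' = true).card

/-- The number of north steps (`false`) of the step sequence `s` strictly before
position `r`. -/
def northsBefore {mn : ℕ} (s : Fin mn → Bool) (r : Fin mn) : ℕ :=
  (Finset.univ.filter fun r' : Fin mn => r' < r ∧ s r' = false).card

/-- The pair of non-decreasing sequences `(a, b)` is bounded by the lattice path from
`(0,0)` to `(m,n)` encoded by the step sequence `s : Fin (m+n) → Bool` (`true` = east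
step `E`, `false` = north step `N`; the path has exactly `m` east steps), with respect
to the weights `U = {(u_{i,j}, v_{i,j})}`: whenever a step starts at `(i,j)`, an east
step requires `a_i < u_{i,j}` and a north step requires `b_j < v_{i,j}`. -/
def BoundedByPath (m n : ℕ) (u v : ℕ → ℕ → ℕ) (a : Fin m → ℕ) (b : Fin n → ℕ)
    (s : Fin (m + n) → Bool) : Prop :=
  (Finset.univ.filter fun r : Fin (m + n) => s r = true).card = m ∧
  ∀ r : Fin (m + n),
    if s r then
      ∀ h : eastsBefore s r < m, a ⟨eastsBefore s r, h⟩ < u (eastsBefore s r) (northsBefore s r)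
    else
      ∀ h : northsBefore s r < n, b ⟨northsBefore s r, h⟩ < v (eastsBefore s r) (northsBefore s r)

/-! ### Algebraic part -/

section Alg
open MvPolynomial

lemma gc_upf_sub_one {R : Type*} [CommRing R] (t : R) (k : ℕ) :
    upf (t - 1) (k + 1) = (t - 1) * upf t k := by
  induction k with
  | zero => simp [upf]
  | succ k ih =>
    rw [upf, ih, upf]
    push_cast
    ring

lemma gc_upf_map {R S : Type*} [CommRing R] [CommRing S] (f : R →+* S) (t : R) (k : ℕ) :
    f (upf t k) = upf (f t) k := by
  induction k with
  | zero => simp [upf]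
  | succ k ih => simp [upf, ih]

lemma gc_upf_nat (t k : ℕ) : upf (t : ℚ) k = (k.factorial : ℚ) * (Nat.multichoose t k : ℚ) := by
  have h : upf (t : ℚ) k = (t.ascFactorial k : ℚ) := by
    induction k with
    | zero => simp [upf]
    | succ k ih => rw [upf, ih, Nat.ascFactorial_succ]; push_cast; ring
  rw [h, Nat.ascFactorial_eq_factorial_mul_choose', Nat.multichoose_eq]
  push_cast
  rfl

/-- normalised rising factorial of a variable -/
noncomputable def gcR (c : Fin 2) (k : ℕ) : MvPolynomial (Fin 2) ℚ :=
  C ((k.factorial : ℚ)⁻¹) * upf (X c) k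

lemma gcR_X_mul (c : Fin 2) (k : ℕ) :
    X c * gcR c k = ((k : ℚ) + 1) • gcR c (k + 1) - (k : ℚ) • gcR c k := by
  have h : ((k : ℚ) + 1) * ((k + 1).factorial : ℚ)⁻¹ = (k.factorial : ℚ)⁻¹ := by
    rw [Nat.factorial_succ]
    push_cast
    field_simp
  have h2 : (C ((k : ℚ) + 1) : MvPolynomial (Fin 2) ℚ) * C (((k + 1).factorial : ℚ)⁻¹)
      = C ((k.factorial : ℚ)⁻¹) := by rw [← C_mul, h]
  simp only [gcR, smul_eq_C_mul, upf]
  rw [← mul_assoc (C ((k : ℚ) + 1)), h2]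
  have h3 : (C (k : ℚ) : MvPolynomial (Fin 2) ℚ) = (k : MvPolynomial (Fin 2) ℚ) := by simp
  rw [h3]
  ring

lemma gcR_span (c : Fin 2) (k : ℕ) :
    (X c : MvPolynomial (Fin 2) ℚ) ^ k ∈ Submodule.span ℚ (gcR c '' {i | i ≤ k}) := by
  induction k with
  | zero =>
    apply Submodule.subset_span
    exact ⟨0, by simp, by simp [gcR, upf]⟩
  | succ k ih =>
    rw [pow_succ']
    generalize (X c : MvPolynomial (Fin 2) ℚ) ^ k = P at ih
    induction ih using Submodule.span_induction with
    | mem p hp =>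
      obtain ⟨i, hi, rfl⟩ := hp
      simp only [Set.mem_ofPred_eq] at hi
      rw [gcR_X_mul]
      apply Submodule.sub_mem
      · apply Submodule.smul_mem
        exact Submodule.subset_span ⟨i + 1, by simp; omega, rfl⟩
      · apply Submodule.smul_mem
        exact Submodule.subset_span ⟨i, by simp; omega, rfl⟩
    | zero => simp
    | add p q _ _ hp hq => rw [mul_add]; exact Submodule.add_mem _ hp hq
    | smul r p _ hp => rw [mul_smul_comm]; exact Submodule.smul_mem _ _ hp

lemma gcR_eval (c : Fin 2) (k t : ℕ) (f : Fin 2 → ℚ) (hf : f c = t) :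
    eval f (gcR c k) = (Nat.multichoose t k : ℚ) := by
  rw [gcR, map_mul, eval_C, gc_upf_map (eval f), eval_X, hf, gc_upf_nat]
  have : (k.factorial : ℚ) ≠ 0 := by exact_mod_cast k.factorial_ne_zero
  field_simp

lemma gc_fact (k : ℕ) : (C (((k + 1).factorial : ℚ)⁻¹) : MvPolynomial (Fin 2) ℚ) * ((k : MvPolynomial (Fin 2) ℚ) + 1) =
    C ((k.factorial : ℚ)⁻¹) := by
  have h3 : ((k : MvPolynomial (Fin 2) ℚ) + 1) = C ((k : ℚ) + 1) := by simp
  rw [h3, ← C_mul, Nat.factorial_succ]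
  congr 1
  push_cast
  field_simp

lemma gc_upf_diff (t : MvPolynomial (Fin 2) ℚ) (k : ℕ) :
    C (((k + 1).factorial : ℚ)⁻¹) * upf t (k + 1) - C (((k + 1).factorial : ℚ)⁻¹) * upf (t - 1) (k + 1) =
    C ((k.factorial : ℚ)⁻¹) * upf t k := by
  rw [gc_upf_sub_one, upf]
  linear_combination upf t k * gc_fact k

/-- linear version -/
noncomputable def gcDx : MvPolynomial (Fin 2) ℚ →ₗ[ℚ] MvPolynomial (Fin 2) ℚ :=
  LinearMap.id - (aeval ![X 0 - 1, X 1] : MvPolynomial (Fin 2) ℚ →ₐ[ℚ] MvPolynomial (Fin 2) ℚ).toLinearMap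

/-- linear version -/
noncomputable def gcDy : MvPolynomial (Fin 2) ℚ →ₗ[ℚ] MvPolynomial (Fin 2) ℚ :=
  LinearMap.id - (aeval ![X 0, X 1 - 1] : MvPolynomial (Fin 2) ℚ →ₐ[ℚ] MvPolynomial (Fin 2) ℚ).toLinearMap

lemma gcDx_coe : (bdiffx : MvPolynomial (Fin 2) ℚ → _) = gcDx := by
  funext p; simp [bdiffx, gcDx]

lemma gcDy_coe : (bdiffy : MvPolynomial (Fin 2) ℚ → _) = gcDy := by
  funext p; simp [bdiffy, gcDy]

lemma gc_map_gcR (φ : MvPolynomial (Fin 2) ℚ →ₐ[ℚ] MvPolynomial (Fin 2) ℚ) (c : Fin 2) (k : ℕ) :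
    φ (gcR c k) = C ((k.factorial : ℚ)⁻¹) * upf (φ (X c)) k := by
  rw [gcR, map_mul]
  congr 1
  · exact φ.commutes _
  · exact gc_upf_map φ.toRingHom _ _

lemma gcDx_succ (k l : ℕ) : gcDx (gcR 0 (k + 1) * gcR 1 l) = gcR 0 k * gcR 1 l := by
  have := gc_upf_diff (X 0) k
  simp only [gcDx, LinearMap.sub_apply, LinearMap.id_apply, AlgHom.toLinearMap_apply, map_mul,
    gc_map_gcR]
  simp only [aeval_X, Matrix.cons_val_zero, Matrix.cons_val_one]
  simp only [gcR]
  rw [← this]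
  ring

lemma gcDx_zero (l : ℕ) : gcDx (gcR 0 0 * gcR 1 l) = 0 := by
  simp only [gcDx, LinearMap.sub_apply, LinearMap.id_apply, AlgHom.toLinearMap_apply, map_mul,
    gc_map_gcR]
  simp only [aeval_X, Matrix.cons_val_zero, Matrix.cons_val_one]
  simp [gcR, upf]

lemma gcDy_succ (k l : ℕ) : gcDy (gcR 0 k * gcR 1 (l + 1)) = gcR 0 k * gcR 1 l := by
  have := gc_upf_diff (X 1) l
  simp only [gcDy, LinearMap.sub_apply, LinearMap.id_apply, AlgHom.toLinearMap_apply, map_mul,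
    gc_map_gcR]
  simp only [aeval_X, Matrix.cons_val_zero, Matrix.cons_val_one]
  simp only [gcR]
  rw [← this]
  ring

lemma gcDy_zero (k : ℕ) : gcDy (gcR 0 k * gcR 1 0) = 0 := by
  simp only [gcDy, LinearMap.sub_apply, LinearMap.id_apply, AlgHom.toLinearMap_apply, map_mul,
    gc_map_gcR]
  simp only [aeval_X, Matrix.cons_val_zero, Matrix.cons_val_one]
  simp [gcR, upf]

lemma gcDx_pow (i k l : ℕ) :
    (gcDx ^ i) (gcR 0 k * gcR 1 l) = if i ≤ k then gcR 0 (k - i) * gcR 1 l else 0 := by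
  induction i generalizing k with
  | zero => simp
  | succ i ih =>
    rw [pow_succ, Module.End.mul_apply]
    cases k with
    | zero => rw [gcDx_zero]; simp
    | succ k => rw [gcDx_succ, ih]; simp

lemma gcDy_pow (j k l : ℕ) :
    (gcDy ^ j) (gcR 0 k * gcR 1 l) = if j ≤ l then gcR 0 k * gcR 1 (l - j) else 0 := by
  induction j generalizing l with
  | zero => simp
  | succ j ih =>
    rw [pow_succ, Module.End.mul_apply]
    cases l with
    | zero => rw [gcDy_zero]; simp
    | succ l => rw [gcDy_succ, ih]; simp

lemma gc_lin_ext (m n : ℕ) (L : MvPolynomial (Fin 2) ℚ →ₗ[ℚ] ℚ)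
    (hL : ∀ k ≤ m, ∀ l ≤ n, L (gcR 0 k * gcR 1 l) = 0)
    (g : MvPolynomial (Fin 2) ℚ) (h0 : g.degreeOf 0 ≤ m) (h1 : g.degreeOf 1 ≤ n) : L g = 0 := by
  have key : ∀ k ≤ m, ∀ l ≤ n, L (X 0 ^ k * X 1 ^ l) = 0 := by
    intro k hk l hl
    have hp := gcR_span 0 k
    have hq := gcR_span 1 l
    generalize (X 0 : MvPolynomial (Fin 2) ℚ) ^ k = P at hp ⊢
    generalize (X 1 : MvPolynomial (Fin 2) ℚ) ^ l = Q at hq ⊢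
    induction hp using Submodule.span_induction with
    | mem p hp =>
      obtain ⟨i, hi, rfl⟩ := hp
      induction hq using Submodule.span_induction with
      | mem q hq =>
        obtain ⟨j, hj, rfl⟩ := hq
        exact hL i (le_trans hi hk) j (le_trans hj hl)
      | zero => simp
      | add p q _ _ hp hq => rw [mul_add, map_add, hp, hq, add_zero]
      | smul r p _ hp => rw [mul_smul_comm, map_smul, hp, smul_zero]
    | zero => simp
    | add p q _ _ hp hq => rw [add_mul, map_add, hp, hq, add_zero]
    | smul r p _ hp => rw [smul_mul_assoc, map_smul, hp, smul_zero]
  rw [g.as_sum, map_sum]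
  apply Finset.sum_eq_zero
  intro d hd
  have hd0 : d 0 ≤ m := le_trans (monomial_le_degreeOf 0 hd) h0
  have hd1 : d 1 ≤ n := le_trans (monomial_le_degreeOf 1 hd) h1
  have : monomial d (coeff d g) = (coeff d g) • ((X 0 : MvPolynomial (Fin 2) ℚ) ^ (d 0) * X 1 ^ (d 1)) := by
    rw [monomial_eq, smul_eq_C_mul, Finsupp.prod_fintype _ _ (by simp)]
    simp
  rw [this, map_smul, key _ hd0 _ hd1, smul_zero]

lemma gc_alg (x y m n : ℕ) (u v K : ℕ → ℕ → ℕ)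
    (hu : ∀ i ≤ m, ∀ j ≤ n, u i j ≤ x)
    (hv : ∀ i ≤ m, ∀ j ≤ n, v i j ≤ y)
    (hK : ∀ k ≤ m, ∀ l ≤ n, Nat.multichoose x k * Nat.multichoose y l =
      ∑ i ∈ range (k + 1), ∑ j ∈ range (l + 1), K i j *
        (Nat.multichoose (x - u i j) (k - i) * Nat.multichoose (y - v i j) (l - j)))
    (g : MvPolynomial (Fin 2) ℚ)
    (hg : IsDiffGoncarov2 m n (fun i j => ((x : ℚ) - (u i j : ℚ), (y : ℚ) - (v i j : ℚ))) g) :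
    (K m n : ℚ) = ((m.factorial : ℚ) * (n.factorial : ℚ))⁻¹ * eval ![(x : ℚ), (y : ℚ)] g := by
  obtain ⟨h0, h1, h2⟩ := hg
  let ev (f : Fin 2 → ℚ) : MvPolynomial (Fin 2) ℚ →ₗ[ℚ] ℚ := (aeval f).toLinearMap
  have hev : ∀ f p, ev f p = eval f p := fun f p => by simp [ev, aeval_eq_eval]
  let L : MvPolynomial (Fin 2) ℚ →ₗ[ℚ] ℚ := ev ![(x : ℚ), (y : ℚ)] -
    ∑ i ∈ range (m + 1), ∑ j ∈ range (n + 1), (K i j : ℚ) •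
      (ev ![(x : ℚ) - (u i j : ℚ), (y : ℚ) - (v i j : ℚ)] ∘ₗ (gcDx ^ i) ∘ₗ (gcDy ^ j))
  have hLdef : ∀ p, L p = eval ![(x : ℚ), (y : ℚ)] p -
    ∑ i ∈ range (m + 1), ∑ j ∈ range (n + 1), (K i j : ℚ) *
      eval ![(x : ℚ) - (u i j : ℚ), (y : ℚ) - (v i j : ℚ)] ((gcDx ^ i) ((gcDy ^ j) p)) := by
    intro p
    simp [L, LinearMap.sum_apply, hev]
  have hLg := gc_lin_ext m n L ?_ g h0 h1
  · rw [hLdef, sub_eq_zero] at hLg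
    rw [hLg]
    rw [Finset.sum_eq_single m, Finset.sum_eq_single n]
    · have := h2 m le_rfl n le_rfl
      rw [gcDx_coe, gcDy_coe, ← Module.End.coe_pow, ← Module.End.coe_pow] at this
      simp only [and_self, if_true] at this
      rw [this]
      have : (m.factorial : ℚ) ≠ 0 := by exact_mod_cast m.factorial_ne_zero
      have : (n.factorial : ℚ) ≠ 0 := by exact_mod_cast n.factorial_ne_zero
      field_simp
    · intro j hj hjn
      have := h2 m le_rfl j (by simp at hj; omega)
      rw [gcDx_coe, gcDy_coe, ← Module.End.coe_pow, ← Module.End.coe_pow] at this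
      simp only [hjn, and_false, if_false] at this
      rw [this, mul_zero]
    · simp
    · intro i hi him
      apply Finset.sum_eq_zero
      intro j hj
      have := h2 i (by simp at hi; omega) j (by simp at hj; omega)
      rw [gcDx_coe, gcDy_coe, ← Module.End.coe_pow, ← Module.End.coe_pow] at this
      simp only [him, false_and, if_false] at this
      rw [this, mul_zero]
    · simp
  · intro k hk l hl
    rw [hLdef, sub_eq_zero, map_mul, gcR_eval 0 k x _ (by simp), gcR_eval 1 l y _ (by simp)]
    have := hK k hk l hl
    rw [← Nat.cast_mul, this]
    push_cast
    have hsub : range (k + 1) ⊆ range (m + 1) := by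
      intro i; simp; omega
    have hsub' : range (l + 1) ⊆ range (n + 1) := by
      intro i; simp; omega
    rw [← Finset.sum_subset hsub]
    · apply Finset.sum_congr rfl
      intro i hi
      rw [← Finset.sum_subset hsub']
      · apply Finset.sum_congr rfl
        intro j hj
        simp only [Finset.mem_range] at hi hj
        rw [gcDy_pow, if_pos (by omega), gcDx_pow, if_pos (by omega), map_mul,
          gcR_eval 0 _ (x - u i j) _ ?_, gcR_eval 1 _ (y - v i j) _ ?_]
        · simp [Nat.cast_sub (hv i (by omega) j (by omega))]
        · simp [Nat.cast_sub (hu i (by omega) j (by omega))]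
      · intro j _ hj
        simp only [Finset.mem_range] at hj
        rw [gcDy_pow, if_neg (by omega)]
        simp
    · intro i _ hi
      simp only [Finset.mem_range] at hi
      apply Finset.sum_eq_zero
      intro j _
      rw [gcDy_pow]
      split_ifs
      · rw [gcDx_pow, if_neg (by omega)]
        simp
      · simp

end Alg

/-! ### Sequences -/

/-- monotone sequences of length `k` with values below `x`, padded by the sentinel `x` -/
def GcSeq (x k : ℕ) : Type :=
  {a : ℕ → ℕ // Monotone a ∧ (∀ t < k, a t < x) ∧ ∀ t, k ≤ t → a t = x}

lemma gc_seq_zero (x : ℕ) : Nonempty (GcSeq x 0 ≃ Unit) :=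
  ⟨{ toFun := fun _ => ()
     invFun := fun _ => ⟨fun _ => x, monotone_const, by simp, by simp⟩
     left_inv := by
      rintro ⟨a, h1, h2, h3⟩
      apply Subtype.ext
      funext t
      exact (h3 t (Nat.zero_le _)).symm
     right_inv := fun _ => rfl }⟩

lemma gc_seq_empty (k : ℕ) : IsEmpty (GcSeq 0 (k + 1)) :=
  ⟨fun a => by simpa using a.2.2.1 0 (Nat.succ_pos _)⟩

/-- prepend a zero -/
def gcCons {x k : ℕ} (a : GcSeq (x + 1) k) : GcSeq (x + 1) (k + 1) :=
  ⟨fun t => if t = 0 then 0 else a.1 (t - 1), by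
    intro s t hst
    by_cases hs : s = 0
    · simp [hs]
    · have : t ≠ 0 := by omega
      simp only [hs, this, if_false]
      exact a.2.1 (by omega), by
    intro t ht
    by_cases hs : t = 0
    · simp [hs]
    · simp only [hs, if_false]
      exact a.2.2.1 _ (by omega), by
    intro t ht
    have : t ≠ 0 := by omega
    simp only [this, if_false]
    exact a.2.2.2 _ (by omega)⟩

/-- drop the first entry -/
def gcTail {x k : ℕ} (a : GcSeq x (k + 1)) : GcSeq x k :=
  ⟨fun t => a.1 (t + 1), fun s t hst => a.2.1 (by omega), fun t ht => a.2.2.1 _ (by omega),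
    fun t ht => a.2.2.2 _ (by omega)⟩

/-- raise by one -/
def gcUp {x k : ℕ} (a : GcSeq x k) : GcSeq (x + 1) k :=
  ⟨fun t => a.1 t + 1, fun s t hst => by simpa using a.2.1 hst,
    fun t ht => by have := a.2.2.1 t ht; dsimp only; omega,
    fun t ht => by have := a.2.2.2 t ht; dsimp only; omega⟩

/-- lower by one -/
def gcDown {x k : ℕ} (a : GcSeq (x + 1) k) (h : a.1 0 ≠ 0) : GcSeq x k :=
  have hp : ∀ t, 1 ≤ a.1 t := fun t => by have := a.2.1 (Nat.zero_le t); omega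
  ⟨fun t => a.1 t - 1, fun s t hst => by have := a.2.1 hst; dsimp only; omega,
    fun t ht => by have := a.2.2.1 t ht; have := hp t; dsimp only; omega,
    fun t ht => by have := a.2.2.2 t ht; dsimp only; omega⟩

/-- Pascal recurrence -/
noncomputable def gcPascal (x k : ℕ) :
    GcSeq (x + 1) (k + 1) ≃ GcSeq x (k + 1) ⊕ GcSeq (x + 1) k where
  toFun a := if h : a.1 0 = 0 then Sum.inr (gcTail a) else Sum.inl (gcDown a h)
  invFun s := s.elim gcUp gcCons
  left_inv a := by
    by_cases h : a.1 0 = 0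
    · simp only [h, dite_true, Sum.elim_inr]
      apply Subtype.ext
      funext t
      by_cases ht : t = 0
      · simp [gcCons, ht, h]
      · simp only [gcCons, gcTail, ht, if_false]
        rw [Nat.sub_add_cancel (by omega)]
    · simp only [h, dite_false, Sum.elim_inl]
      apply Subtype.ext
      funext t
      have := a.2.1 (Nat.zero_le t)
      simp only [gcUp, gcDown]
      omega
  right_inv s := by
    rcases s with a | a
    · have : (gcUp a).1 0 ≠ 0 := by simp [gcUp]
      simp only [Sum.elim_inl, this, dite_false]
      congr 1
    · have : (gcCons a).1 0 = 0 := by simp [gcCons]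
      simp only [Sum.elim_inr, this, dite_true]
      congr 1

lemma gc_seq_card (x k : ℕ) : Finite (GcSeq x k) ∧ Nat.card (GcSeq x k) = Nat.multichoose x k := by
  induction x generalizing k with
  | zero =>
    cases k with
    | zero =>
      obtain ⟨e⟩ := gc_seq_zero 0
      exact ⟨Finite.of_equiv _ e.symm, by simp [Nat.card_congr e]⟩
    | succ k =>
      have := gc_seq_empty k
      exact ⟨inferInstance, by simp⟩
  | succ x ihx =>
    induction k with
    | zero =>
      obtain ⟨e⟩ := gc_seq_zero (x + 1)
      exact ⟨Finite.of_equiv _ e.symm, by simp [Nat.card_congr e]⟩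
    | succ k ihk =>
      obtain ⟨f1, c1⟩ := ihx (k + 1)
      obtain ⟨f2, c2⟩ := ihk
      refine ⟨Finite.of_equiv _ (gcPascal x k).symm, ?_⟩
      rw [Nat.card_congr (gcPascal x k), Nat.card_sum, c1, c2, Nat.multichoose_succ_succ]

instance gc_seq_finite (x k : ℕ) : Finite (GcSeq x k) := (gc_seq_card x k).1

/-- points reachable by a path bounding the pair -/
inductive GcReach (u v : ℕ → ℕ → ℕ) (a b : ℕ → ℕ) : ℕ → ℕ → Prop
  | zero : GcReach u v a b 0 0
  | east (i j : ℕ) : GcReach u v a b i j → a i < u i j → GcReach u v a b (i + 1) j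
  | north (i j : ℕ) : GcReach u v a b i j → b j < v i j → GcReach u v a b i (j + 1)

lemma gc_reach_congr {u v u' v' : ℕ → ℕ → ℕ} {a b a' b' : ℕ → ℕ} {i j : ℕ}
    (h : GcReach u v a b i j)
    (hu : ∀ p ≤ i, ∀ q ≤ j, u p q = u' p q) (hv : ∀ p ≤ i, ∀ q ≤ j, v p q = v' p q)
    (ha : ∀ p < i, a p = a' p) (hb : ∀ q < j, b q = b' q) : GcReach u' v' a' b' i j := by
  induction h with
  | zero => exact .zero
  | east i j _ h ih =>
    refine .east i j (ih (fun p hp q hq => hu p (by omega) q hq)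
      (fun p hp q hq => hv p (by omega) q hq) (fun p hp => ha p (by omega)) hb) ?_
    rw [← ha i (by omega), ← hu i (by omega) j le_rfl]
    exact h
  | north i j _ h ih =>
    refine .north i j (ih (fun p hp q hq => hu p hp q (by omega))
      (fun p hp q hq => hv p hp q (by omega)) ha (fun p hp => hb p (by omega))) ?_
    rw [← hb j (by omega), ← hv i le_rfl j (by omega)]
    exact h

section Comb
variable {u v : ℕ → ℕ → ℕ} {x y : ℕ}

lemma gc_reach_le (hum : ∀ i i' j j', i ≤ i' → j ≤ j' → u i j ≤ u i' j')
    (hvm : ∀ i i' j j', i ≤ i' → j ≤ j' → v i j ≤ v i' j')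
    {a b : ℕ → ℕ} {i j p q : ℕ} (ha : u i j ≤ a i) (hb : v i j ≤ b j)
    (h : GcReach u v a b p q) : p ≤ i ∧ q ≤ j := by
  induction h with
  | zero => simp
  | east p q _ h ih =>
    refine ⟨?_, ih.2⟩
    by_contra hc
    have : p = i := by omega
    subst this
    have := hum p p q j le_rfl ih.2
    omega
  | north p q _ h ih =>
    refine ⟨ih.1, ?_⟩
    by_contra hc
    have : q = j := by omega
    subst this
    have := hvm p i q q ih.1 le_rfl
    omega

lemma gc_reach_last_a (hum : ∀ i i' j j', i ≤ i' → j ≤ j' → u i j ≤ u i' j')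
    {a b : ℕ → ℕ} {i j : ℕ} (h : GcReach u v a b i j) : ∀ p < i, a p < u i j := by
  induction h with
  | zero => simp
  | east i j _ h ih =>
    intro p hp
    have := hum i (i + 1) j j (by omega) le_rfl
    rcases Nat.lt_succ_iff_lt_or_eq.1 hp with h' | rfl
    · have := ih p h'; omega
    · omega
  | north i j _ h ih =>
    intro p hp
    have := hum i i j (j + 1) le_rfl (by omega)
    have := ih p hp
    omega

lemma gc_reach_last_b (hvm : ∀ i i' j j', i ≤ i' → j ≤ j' → v i j ≤ v i' j')
    {a b : ℕ → ℕ} {i j : ℕ} (h : GcReach u v a b i j) : ∀ q < j, b q < v i j := by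
  induction h with
  | zero => simp
  | east i j _ h ih =>
    intro p hp
    have := hvm i (i + 1) j j (by omega) le_rfl
    have := ih p hp
    omega
  | north i j _ h ih =>
    intro p hp
    have := hvm i i j (j + 1) le_rfl (by omega)
    rcases Nat.lt_succ_iff_lt_or_eq.1 hp with h' | rfl
    · have := ih p h'; omega
    · omega

lemma gc_reach_bound (hux : ∀ i j, u i j ≤ x) (hvy : ∀ i j, v i j ≤ y) {k l : ℕ}
    (a : GcSeq x k) (b : GcSeq y l) {i j : ℕ} (h : GcReach u v a.1 b.1 i j) : i ≤ k ∧ j ≤ l := by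
  induction h with
  | zero => simp
  | east i j _ h ih =>
    refine ⟨?_, ih.2⟩
    by_contra hc
    have := a.2.2.2 i (by omega)
    have := hux i j
    omega
  | north i j _ h ih =>
    refine ⟨ih.1, ?_⟩
    by_contra hc
    have := b.2.2.2 j (by omega)
    have := hvy i j
    omega

lemma gc_stuck_exists (hux : ∀ i j, u i j ≤ x) (hvy : ∀ i j, v i j ≤ y) {k l : ℕ}
    (a : GcSeq x k) (b : GcSeq y l) :
    ∃ i j, GcReach u v a.1 b.1 i j ∧ u i j ≤ a.1 i ∧ v i j ≤ b.1 j := by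
  by_contra hc
  push Not at hc
  have : ∀ r, ∃ i j, i + j = r ∧ GcReach u v a.1 b.1 i j := by
    intro r
    induction r with
    | zero => exact ⟨0, 0, rfl, .zero⟩
    | succ r ih =>
      obtain ⟨i, j, hr, h⟩ := ih
      by_cases ha : u i j ≤ a.1 i
      · exact ⟨i, j + 1, by omega, .north _ _ h (hc i j h ha)⟩
      · exact ⟨i + 1, j, by omega, .east _ _ h (by omega)⟩
  obtain ⟨i, j, hr, h⟩ := this (k + l + 1)
  have := gc_reach_bound hux hvy a b h
  omega

/-- head of a sequence -/
def gcHead {k : ℕ} (i : ℕ) (hi : i ≤ k) (a : GcSeq x k) : GcSeq x i :=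
  ⟨fun t => if t < i then a.1 t else x, by
    intro s t hst
    have h1 := a.2.1 hst
    have h2 := a.2.2.1 s
    dsimp only
    split_ifs <;> first | omega | (have := h2 (by omega); omega), by
    intro t ht
    simp only [ht, if_true]
    exact a.2.2.1 t (by omega), by
    intro t ht
    simp [Nat.not_lt.2 ht]⟩

/-- shifted tail of a sequence -/
def gcDrop {k : ℕ} (i w : ℕ) (hi : i ≤ k) (a : GcSeq x k) (h : w ≤ a.1 i) :
    GcSeq (x - w) (k - i) :=
  have hp : ∀ t, w ≤ a.1 (t + i) := fun t => le_trans h (a.2.1 (by omega))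
  ⟨fun t => a.1 (t + i) - w, by
    intro s t hst
    have h1 := a.2.1 (show s + i ≤ t + i by omega)
    dsimp only
    omega, by
    intro t ht
    have := a.2.2.1 (t + i) (by omega)
    have := hp t
    dsimp only
    omega, by
    intro t ht
    have := a.2.2.2 (t + i) (by omega)
    dsimp only
    omega⟩

/-- glue -/
def gcGlue {k : ℕ} (i w : ℕ) (hi : i ≤ k) (hw : w ≤ x) (a : GcSeq x i) (c : GcSeq (x - w) (k - i))
    (h : ∀ p < i, a.1 p < w) : GcSeq x k :=
  ⟨fun t => if t < i then a.1 t else c.1 (t - i) + w, by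
    intro s t hst
    have h1 := a.2.1 hst
    have h2 := c.2.1 (show s - i ≤ t - i by omega)
    have h3 := h s
    dsimp only
    split_ifs <;> first | omega | (have := h3 (by omega); omega), by
    intro t ht
    dsimp only
    split_ifs with hti
    · exact a.2.2.1 t hti
    · have := c.2.2.1 (t - i) (by omega)
      omega, by
    intro t ht
    have := c.2.2.2 (t - i) (by omega)
    have h0 : ¬ t < i := by omega
    simp only [h0, if_false]
    omega⟩

/-- the pairs counted by the theorem, in padded form -/
def GcK (u v : ℕ → ℕ → ℕ) (x y i j : ℕ) : Type :=
  {p : GcSeq x i × GcSeq y j // GcReach u v p.1.1 p.2.1 i j}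

lemma gc_stuck_card (hum : ∀ i i' j j', i ≤ i' → j ≤ j' → u i j ≤ u i' j')
    (hvm : ∀ i i' j j', i ≤ i' → j ≤ j' → v i j ≤ v i' j')
    (hux : ∀ i j, u i j ≤ x) (hvy : ∀ i j, v i j ≤ y) {k l : ℕ} (i j : ℕ) (hi : i ≤ k) (hj : j ≤ l) :
    Nat.card {p : GcSeq x k × GcSeq y l //
      GcReach u v p.1.1 p.2.1 i j ∧ u i j ≤ p.1.1 i ∧ v i j ≤ p.2.1 j} =
    Nat.card (GcK u v x y i j) *
      (Nat.multichoose (x - u i j) (k - i) * Nat.multichoose (y - v i j) (l - j)) := by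
  rw [← (gc_seq_card _ _).2, ← (gc_seq_card _ _).2, ← Nat.card_prod, ← Nat.card_prod]
  apply Nat.card_congr
  refine
    { toFun := fun p => (⟨(gcHead i hi p.1.1, gcHead j hj p.1.2), ?_⟩,
        (gcDrop i (u i j) hi p.1.1 p.2.2.1, gcDrop j (v i j) hj p.1.2 p.2.2.2))
      invFun := fun q => ⟨(gcGlue i (u i j) hi (hux i j) q.1.1.1 q.2.1 (gc_reach_last_a hum q.1.2),
        gcGlue j (v i j) hj (hvy i j) q.1.1.2 q.2.2 (gc_reach_last_b hvm q.1.2)), ?_, ?_, ?_⟩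
      left_inv := ?_
      right_inv := ?_ }
  · refine gc_reach_congr p.2.1 (fun _ _ _ _ => rfl) (fun _ _ _ _ => rfl) ?_ ?_
    · intro t ht; simp [gcHead, ht]
    · intro t ht; simp [gcHead, ht]
  · refine gc_reach_congr q.1.2 (fun _ _ _ _ => rfl) (fun _ _ _ _ => rfl) ?_ ?_
    · intro t ht; simp [gcGlue, ht]
    · intro t ht; simp [gcGlue, ht]
  · simp [gcGlue]
  · simp [gcGlue]
  · rintro ⟨⟨a, b⟩, h1, h2, h3⟩
    apply Subtype.ext
    apply Prod.ext
    · apply Subtype.ext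
      funext t
      simp only [gcGlue, gcHead, gcDrop]
      dsimp only at h2
      split_ifs with ht
      · rfl
      · have := a.2.1 (show i ≤ t by omega)
        rw [Nat.sub_add_cancel (by omega : i ≤ t)]
        omega
    · apply Subtype.ext
      funext t
      simp only [gcGlue, gcHead, gcDrop]
      dsimp only at h3
      split_ifs with ht
      · rfl
      · have := b.2.1 (show j ≤ t by omega)
        rw [Nat.sub_add_cancel (by omega : j ≤ t)]
        omega
  · rintro ⟨⟨⟨a, b⟩, h1⟩, c, d⟩
    apply Prod.ext
    · apply Subtype.ext
      apply Prod.ext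
      · apply Subtype.ext
        funext t
        simp only [gcGlue, gcHead]
        split_ifs with ht
        · rfl
        · exact (a.2.2.2 t (by omega)).symm
      · apply Subtype.ext
        funext t
        simp only [gcGlue, gcHead]
        split_ifs with ht
        · rfl
        · exact (b.2.2.2 t (by omega)).symm
    · apply Prod.ext
      · apply Subtype.ext
        funext t
        simp [gcGlue, gcDrop]
      · apply Subtype.ext
        funext t
        simp [gcGlue, gcDrop]

lemma gc_comb (hum : ∀ i i' j j', i ≤ i' → j ≤ j' → u i j ≤ u i' j')
    (hvm : ∀ i i' j j', i ≤ i' → j ≤ j' → v i j ≤ v i' j')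
    (hux : ∀ i j, u i j ≤ x) (hvy : ∀ i j, v i j ≤ y) (k l : ℕ) :
    Nat.multichoose x k * Nat.multichoose y l =
      ∑ i ∈ range (k + 1), ∑ j ∈ range (l + 1), Nat.card (GcK u v x y i j) *
        (Nat.multichoose (x - u i j) (k - i) * Nat.multichoose (y - v i j) (l - j)) := by
  classical
  have : Fintype (GcSeq x k × GcSeq y l) := Fintype.ofFinite _
  let P : GcSeq x k × GcSeq y l → ℕ × ℕ → Prop := fun p ij =>
    GcReach u v p.1.1 p.2.1 ij.1 ij.2 ∧ u ij.1 ij.2 ≤ p.1.1 ij.1 ∧ v ij.1 ij.2 ≤ p.2.1 ij.2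
  have h := Finset.sum_card_bipartiteAbove_eq_sum_card_bipartiteBelow
    (s := (Finset.univ : Finset (GcSeq x k × GcSeq y l)))
    (t := range (k + 1) ×ˢ range (l + 1)) P
  have h1 : ∀ p ∈ (Finset.univ : Finset (GcSeq x k × GcSeq y l)),
      (Finset.bipartiteAbove P (range (k + 1) ×ˢ range (l + 1)) p).card = 1 := by
    intro p _
    obtain ⟨i, j, hr, ha, hb⟩ := gc_stuck_exists hux hvy p.1 p.2
    rw [Finset.card_eq_one]
    refine ⟨(i, j), ?_⟩
    ext ⟨i', j'⟩
    simp only [Finset.bipartiteAbove, Finset.mem_filter, Finset.mem_product, Finset.mem_range,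
      Finset.mem_singleton, Prod.mk.injEq, P]
    constructor
    · rintro ⟨_, hr', ha', hb'⟩
      have := gc_reach_le hum hvm ha hb hr'
      have := gc_reach_le hum hvm ha' hb' hr
      omega
    · rintro ⟨rfl, rfl⟩
      have := gc_reach_bound hux hvy p.1 p.2 hr
      exact ⟨by omega, hr, ha, hb⟩
  rw [Finset.sum_congr rfl h1, Finset.sum_const, Finset.card_univ, ← Nat.card_eq_fintype_card,
    Nat.card_prod, (gc_seq_card _ _).2, (gc_seq_card _ _).2, smul_eq_mul, mul_one,
    Finset.sum_product] at h
  rw [h]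
  apply Finset.sum_congr rfl
  intro i hi
  apply Finset.sum_congr rfl
  intro j hj
  simp only [Finset.mem_range] at hi hj
  rw [← gc_stuck_card hum hvm hux hvy i j (by omega) (by omega), Nat.card_eq_fintype_card,
    Fintype.card_subtype]
  rfl

end Comb

/-! ### Paths -/

lemma gc_count_compl (s : ℕ → Bool) (r : ℕ) :
    Nat.count (fun t => s t = true) r + Nat.count (fun t => s t = false) r = r := by
  induction r with
  | zero => simp
  | succ r ih =>
    rw [Nat.count_succ, Nat.count_succ]
    cases h : s r <;> simp <;> omega

lemma gc_card_count {N : ℕ} (s : ℕ → Bool) (c : Bool) (r : ℕ) (hr : r ≤ N) :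
    (Finset.univ.filter fun t : Fin N => t.val < r ∧ s t.val = c).card =
      Nat.count (fun t => s t = c) r := by
  rw [Nat.count_eq_card_filter_range]
  apply Finset.card_bij (fun t _ => t.val)
  · intro t; simp
  · intro t _ t' _ h; exact Fin.ext h
  · intro t ht
    simp only [Finset.mem_filter, Finset.mem_range] at ht
    exact ⟨⟨t, by omega⟩, by simp [ht], rfl⟩

lemma gc_path_nat (u v : ℕ → ℕ → ℕ) (a b : ℕ → ℕ) (m n : ℕ) :
    GcReach u v a b m n ↔ ∃ s : ℕ → Bool, Nat.count (fun t => s t = true) (m + n) = m ∧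
      ∀ r < m + n, if s r then
        a (Nat.count (fun t => s t = true) r) <
          u (Nat.count (fun t => s t = true) r) (Nat.count (fun t => s t = false) r)
      else b (Nat.count (fun t => s t = false) r) <
          v (Nat.count (fun t => s t = true) r) (Nat.count (fun t => s t = false) r) := by
  constructor
  · have upd : ∀ (s : ℕ → Bool) (c d : Bool) (N r : ℕ), r ≤ N →
        Nat.count (fun t => Function.update s N d t = c) r = Nat.count (fun t => s t = c) r := by
      intro s c d N r hr
      rw [Nat.count_eq_card_filter_range, Nat.count_eq_card_filter_range]
      congr 1
      apply Finset.filter_congr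
      intro t ht
      simp only [Finset.mem_range] at ht
      rw [Function.update_of_ne (by omega)]
    intro h
    induction h with
    | zero => exact ⟨fun _ => true, by simp, by simp⟩
    | east i j _ h ih =>
      obtain ⟨s, h1, h2⟩ := ih
      have h3 := gc_count_compl s (i + j)
      refine ⟨Function.update s (i + j) true, ?_, ?_⟩
      · rw [show i + 1 + j = (i + j) + 1 by ring, Nat.count_succ, upd _ _ _ _ _ le_rfl]
        simp [h1]
      · intro r hr
        rw [upd _ _ _ _ _ (by omega), upd _ _ _ _ _ (by omega)]
        by_cases hrN : r = i + j
        · subst hrN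
          have h4 : Nat.count (fun t => s t = false) (i + j) = j := by omega
          simp only [Function.update_self, if_true, h1, h4]
          exact h
        · rw [Function.update_of_ne hrN]
          exact h2 r (by omega)
    | north i j _ h ih =>
      obtain ⟨s, h1, h2⟩ := ih
      have h3 := gc_count_compl s (i + j)
      refine ⟨Function.update s (i + j) false, ?_, ?_⟩
      · rw [show i + (j + 1) = (i + j) + 1 by ring, Nat.count_succ, upd _ _ _ _ _ le_rfl]
        simp [h1]
      · intro r hr
        rw [upd _ _ _ _ _ (by omega), upd _ _ _ _ _ (by omega)]
        by_cases hrN : r = i + j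
        · subst hrN
          have h4 : Nat.count (fun t => s t = false) (i + j) = j := by omega
          simp only [Function.update_self, Bool.false_eq_true, if_false, h1, h4]
          exact h
        · rw [Function.update_of_ne hrN]
          exact h2 r (by omega)
  · rintro ⟨s, h1, h2⟩
    have key : ∀ r ≤ m + n, GcReach u v a b (Nat.count (fun t => s t = true) r)
        (Nat.count (fun t => s t = false) r) := by
      intro r
      induction r with
      | zero => intro _; simpa using GcReach.zero
      | succ r ih =>
        intro hr
        have ih' := ih (by omega)
        have h := h2 r (by omega)
        rw [Nat.count_succ, Nat.count_succ]
        cases hs : s r with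
        | true =>
          simp only [hs, if_true] at h
          simpa using GcReach.east _ _ ih' h
        | false =>
          simp only [hs, Bool.false_eq_true, if_false] at h
          simpa using GcReach.north _ _ ih' h
    have h3 := key (m + n) le_rfl
    have h4 := gc_count_compl s (m + n)
    rw [h1] at h3
    rwa [show Nat.count (fun t => s t = false) (m + n) = n by omega] at h3

lemma gc_path (u v : ℕ → ℕ → ℕ) (m n : ℕ) (a : Fin m → ℕ) (b : Fin n → ℕ) (a' b' : ℕ → ℕ)
    (ha : ∀ i : Fin m, a' i = a i) (hb : ∀ i : Fin n, b' i = b i) :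
    (∃ s : Fin (m + n) → Bool, BoundedByPath m n u v a b s) ↔ GcReach u v a' b' m n := by
  rw [gc_path_nat]
  have main : ∀ s : ℕ → Bool, BoundedByPath m n u v a b (fun r => s r.val) ↔
      Nat.count (fun t => s t = true) (m + n) = m ∧
      ∀ r < m + n, if s r then
        a' (Nat.count (fun t => s t = true) r) <
          u (Nat.count (fun t => s t = true) r) (Nat.count (fun t => s t = false) r)
      else b' (Nat.count (fun t => s t = false) r) <
          v (Nat.count (fun t => s t = true) r) (Nat.count (fun t => s t = false) r) := by
    intro s
    have hE : ∀ r : Fin (m + n), eastsBefore (fun r : Fin (m + n) => s r.val) r =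
        Nat.count (fun t => s t = true) r.val := fun r => gc_card_count s true r.val r.2.le
    have hN : ∀ r : Fin (m + n), northsBefore (fun r : Fin (m + n) => s r.val) r =
        Nat.count (fun t => s t = false) r.val := fun r => gc_card_count s false r.val r.2.le
    have hT : (Finset.univ.filter fun r : Fin (m + n) => s r.val = true).card =
        Nat.count (fun t => s t = true) (m + n) := by
      rw [← gc_card_count s true (m + n) le_rfl]
      congr 1
      apply Finset.filter_congr
      intro t _
      simp
    unfold BoundedByPath
    rw [hT]
    apply and_congr_right
    intro h1
    have h1' : Nat.count (fun t => s t = false) (m + n) = n := by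
      have := gc_count_compl s (m + n); omega
    rw [Fin.forall_iff]
    apply forall_congr'
    intro r
    apply forall_congr'
    intro hr
    simp only [hE, hN]
    cases hs : s r with
    | true =>
      have hlt : Nat.count (fun t => s t = true) r < m := by
        have := Nat.count_monotone (fun t => s t = true) (show r + 1 ≤ m + n by omega)
        rw [Nat.count_succ, if_pos hs, h1] at this
        omega
      simp only [if_true]
      have h5 := ha ⟨_, hlt⟩
      simp only at h5
      rw [h5]
      exact ⟨fun h => h hlt, fun h _ => h⟩
    | false =>
      have hlt : Nat.count (fun t => s t = false) r < n := by
        have := Nat.count_monotone (fun t => s t = false) (show r + 1 ≤ m + n by omega)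
        rw [Nat.count_succ, if_pos hs, h1'] at this
        omega
      simp only [Bool.false_eq_true, if_false]
      have h5 := hb ⟨_, hlt⟩
      simp only at h5
      rw [h5]
      exact ⟨fun h => h hlt, fun h _ => h⟩
  constructor
  · rintro ⟨s, hs⟩
    refine ⟨fun t => if h : t < m + n then s ⟨t, h⟩ else true, (main _).1 ?_⟩
    have : (fun r : Fin (m + n) => (fun t => if h : t < m + n then s ⟨t, h⟩ else true) r.val) = s := by
      funext r
      simp
    rw [this]
    exact hs
  · rintro ⟨s, hs⟩
    exact ⟨_, (main s).2 hs⟩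

/-- pad a finite sequence -/
def gcPad (x m : ℕ) (a : Fin m → ℕ) : ℕ → ℕ := fun t => if h : t < m then a ⟨t, h⟩ else x

lemma gc_pad_mem {x m : ℕ} {a : Fin m → ℕ} (h : Monotone a) (hx : ∀ i, a i < x) :
    Monotone (gcPad x m a) ∧ (∀ t < m, gcPad x m a t < x) ∧ ∀ t, m ≤ t → gcPad x m a t = x := by
  refine ⟨?_, ?_, ?_⟩
  · intro s t hst
    unfold gcPad
    split_ifs with h1 h2
    · exact h hst
    · exact (hx _).le
    · omega
    · exact le_rfl
  · intro t ht
    simp [gcPad, ht, hx]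
  · intro t ht
    simp [gcPad, Nat.not_lt.2 ht]

lemma gc_main_card (x y m n : ℕ) (u v : ℕ → ℕ → ℕ) :
    Nat.card {ab : (Fin m → ℕ) × (Fin n → ℕ) //
        Monotone ab.1 ∧ Monotone ab.2 ∧
        (∀ i, ab.1 i < x) ∧ (∀ j, ab.2 j < y) ∧
        ∃ s : Fin (m + n) → Bool, BoundedByPath m n u v ab.1 ab.2 s} =
    Nat.card (GcK u v x y m n) := by
  apply Nat.card_congr
  refine
    { toFun := fun p => ⟨(⟨gcPad x m p.1.1, gc_pad_mem p.2.1 p.2.2.2.1⟩,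
        ⟨gcPad y n p.1.2, gc_pad_mem p.2.2.1 p.2.2.2.2.1⟩), ?_⟩
      invFun := fun q => ⟨(fun i => q.1.1.1 i, fun j => q.1.2.1 j), ?_, ?_, ?_, ?_, ?_⟩
      left_inv := ?_
      right_inv := ?_ }
  · exact (gc_path u v m n p.1.1 p.1.2 _ _ (by simp [gcPad]) (by simp [gcPad])).1 p.2.2.2.2.2
  · intro i j hij
    exact q.1.1.2.1 hij
  · intro i j hij
    exact q.1.2.2.1 hij
  · intro i
    exact q.1.1.2.2.1 i i.2
  · intro i
    exact q.1.2.2.2.1 i i.2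
  · exact (gc_path u v m n _ _ _ _ (fun _ => rfl) (fun _ => rfl)).2 q.2
  · rintro ⟨⟨a, b⟩, h⟩
    apply Subtype.ext
    apply Prod.ext
    · funext i; simp [gcPad]
    · funext i; simp [gcPad]
  · rintro ⟨⟨a, b⟩, h⟩
    apply Subtype.ext
    apply Prod.ext
    · apply Subtype.ext
      funext t
      simp only [gcPad]
      split_ifs with ht
      · rfl
      · exact (a.2.2.2 t (by omega)).symm
    · apply Subtype.ext
      funext t
      simp only [gcPad]
      split_ifs with ht
      · rfl
      · exact (b.2.2.2 t (by omega)).symm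

/-- **Main combinatorial interpretation.** Let `x, y, m, n` be positive integers and
`U = {(u_{i,j}, v_{i,j}) : (i,j) ≼ (m,n)} ⊆ ℕ²` be coordinatewise monotone with
`1 ≤ u_{i,j} ≤ x` and `1 ≤ v_{i,j} ≤ y`.  The number of pairs of non-decreasing
sequences `0 ≤ a_0 ≤ ⋯ ≤ a_{m-1} < x`, `0 ≤ b_0 ≤ ⋯ ≤ b_{n-1} < y` that are bounded
by at least one lattice path from `(0,0)` to `(m,n)` with respect to `U` equals
`(1/(m!·n!)) · g̃_{m,n}((x,y); Z)`, where `Z` is the node set with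
`z_{i,j} = (x - u_{i,j}, y - v_{i,j})` and the Gončarov polynomial is over `ℚ`. -/
theorem main_combinatorial_interpretation (x y m n : ℕ)
    (hx : 0 < x) (hy : 0 < y) (hm : 0 < m) (hn : 0 < n)
    (u v : ℕ → ℕ → ℕ)
    (humono : ∀ i i' j j' : ℕ, i ≤ i' → j ≤ j' → i' ≤ m → j' ≤ n → u i j ≤ u i' j')
    (hvmono : ∀ i i' j j' : ℕ, i ≤ i' → j ≤ j' → i' ≤ m → j' ≤ n → v i j ≤ v i' j')
    (hu : ∀ i ≤ m, ∀ j ≤ n, 1 ≤ u i j ∧ u i j ≤ x)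
    (hv : ∀ i ≤ m, ∀ j ≤ n, 1 ≤ v i j ∧ v i j ≤ y)
    (g : MvPolynomial (Fin 2) ℚ)
    (hg : IsDiffGoncarov2 m n (fun i j => ((x : ℚ) - (u i j : ℚ), (y : ℚ) - (v i j : ℚ))) g) :
    (Nat.card {ab : (Fin m → ℕ) × (Fin n → ℕ) //
        Monotone ab.1 ∧ Monotone ab.2 ∧
        (∀ i, ab.1 i < x) ∧ (∀ j, ab.2 j < y) ∧
        ∃ s : Fin (m + n) → Bool, BoundedByPath m n u v ab.1 ab.2 s} : ℚ) =
      ((m.factorial : ℚ) * (n.factorial : ℚ))⁻¹ *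
        MvPolynomial.eval ![(x : ℚ), (y : ℚ)] g := by
  rw [gc_main_card]
  refine gc_alg x y m n u v (fun i j => Nat.card (GcK u v x y i j)) (fun i hi j hj => (hu i hi j hj).2)
    (fun i hi j hj => (hv i hi j hj).2) ?_ g hg
  intro k hk l hl
  let u' : ℕ → ℕ → ℕ := fun i j => u (min i m) (min j n)
  let v' : ℕ → ℕ → ℕ := fun i j => v (min i m) (min j n)
  have hu' : ∀ i ≤ m, ∀ j ≤ n, u' i j = u i j := by
    intro i hi j hj; simp [u', hi, hj]
  have hv' : ∀ i ≤ m, ∀ j ≤ n, v' i j = v i j := by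
    intro i hi j hj; simp [v', hi, hj]
  have hK : ∀ i ≤ m, ∀ j ≤ n, Nat.card (GcK u v x y i j) = Nat.card (GcK u' v' x y i j) := by
    intro i hi j hj
    apply Nat.card_congr
    apply Equiv.subtypeEquivRight
    intro p
    constructor
    · intro h
      exact gc_reach_congr h (fun p hp q hq => (hu' p (by omega) q (by omega)).symm)
        (fun p hp q hq => (hv' p (by omega) q (by omega)).symm) (fun _ _ => rfl) (fun _ _ => rfl)
    · intro h
      exact gc_reach_congr h (fun p hp q hq => (hu' p (by omega) q (by omega)))
        (fun p hp q hq => (hv' p (by omega) q (by omega))) (fun _ _ => rfl) (fun _ _ => rfl)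
  rw [gc_comb (u := u') (v := v')
    (fun i i' j j' hi hj => humono _ _ _ _ (by omega) (by omega) (by omega) (by omega))
    (fun i i' j j' hi hj => hvmono _ _ _ _ (by omega) (by omega) (by omega) (by omega))
    (fun i j => (hu _ (by omega) _ (by omega)).2) (fun i j => (hv _ (by omega) _ (by omega)).2) k l]
  apply Finset.sum_congr rfl
  intro i hi
  apply Finset.sum_congr rfl
  intro j hj
  simp only [Finset.mem_range] at hi hj
  rw [hK i (by omega) j (by omega), hu' i (by omega) j (by omega), hv' i (by omega) j (by omega)]
end
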